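/- Let p be an odd prime and let F be a field of characteristic different from p containing a primitive p-th root of unity. If there exists a finite Galois field extension K/F whose Galois group Gal(K/F) is a nonabelian group of order p³ and exponent p (i.e. isomorphic to the Heisenberg group H_{p³}), then there exists a finite Galois field extension L/F whose Galois group Gal(L/F) is a nonabelian group of order p³ and exponent p² (i.e. isomorphic to the modular group M_{p³}). -/

import Mathlib

theorem comm_of_card_pow_le {G : Type*} [Group G] {p k : ℕ} (hp : p.Prime) (hk : k ≤ 2)
    (h : Nat.card G = p ^ k) (a b : G) : a * b = b * a := by
  have : Fact p.Prime := ⟨hp⟩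
  interval_cases k
  · have := (Nat.card_eq_one_iff_unique.mp (by simpa using h)).1
    exact Subsingleton.elim _ _
  · have : IsCyclic G := isCyclic_of_prime_card (p := p) (by simpa using h)
    exact (IsCyclic.isMulCommutative (α := G)).is_comm.comm a b
  · exact (IsPGroup.isMulCommutative_of_card_eq_prime_sq h).is_comm.comm a b

theorem heis_comm_central {G : Type*} [Group G] {p : ℕ} (hp : p.Prime)
    (h : Nat.card G = p ^ 3) (a b c : G) : (a⁻¹ * b⁻¹ * a * b) * c = c * (a⁻¹ * b⁻¹ * a * b) := by
  have : Fact p.Prime := ⟨hp⟩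
  obtain ⟨k, hk, hc⟩ := IsPGroup.card_center_eq_prime_pow h (by norm_num)
  have hq := Subgroup.card_eq_card_quotient_mul_card_subgroup (Subgroup.center G)
  have hd : Nat.card (G ⧸ Subgroup.center G) ∣ p ^ 3 := ⟨_, by rw [← h]; exact hq⟩
  obtain ⟨m, hm, hm'⟩ := (Nat.dvd_prime_pow hp).1 hd
  rw [h, hm', hc, ← pow_add] at hq
  have := Nat.pow_right_injective hp.two_le hq
  have hcomm := comm_of_card_pow_le hp (by omega) hm'
  have : (a⁻¹ * b⁻¹ * a * b) ∈ Subgroup.center G := by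
    rw [← QuotientGroup.eq_one_iff]
    have e : ((a⁻¹ * b⁻¹ * a * b : G) : G ⧸ Subgroup.center G) =
      (a : G ⧸ Subgroup.center G)⁻¹ * (b : G ⧸ Subgroup.center G)⁻¹ * (a * b) := by
      rw [mul_assoc]; rfl
    rw [e, hcomm (a : G ⧸ Subgroup.center G) b]
    group
  exact (Subgroup.mem_center_iff.1 this c).symm

theorem heis_group {G : Type*} [Group G] {p : ℕ} (hp : p.Prime)
    (h : Nat.card G = p ^ 3) (he : Monoid.exponent G = p) (s t z : G) (hz : z = t⁻¹ * s⁻¹ * t * s)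
    (hst : t * s ≠ s * t) :
    z ∉ Subgroup.zpowers t ∧ (Subgroup.closure {t, z}).index = p ∧ s ∉ Subgroup.closure {t, z} := by
  have : Fact p.Prime := ⟨hp⟩
  have : Finite G := Nat.finite_of_card_ne_zero (by rw [h]; exact pow_ne_zero _ hp.ne_zero)
  have hzc : ∀ c, z * c = c * z := by subst hz; exact heis_comm_central hp h t s
  have hz1 : z ≠ 1 := by
    rintro rfl
    apply hst
    have : s * t * 1 = s * t * (t⁻¹ * s⁻¹ * t * s) := by rw [← hz]
    rw [mul_one] at this
    rw [this]; group
  have ht1 : t ≠ 1 := by rintro rfl; simp at hst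
  have hord : ∀ g : G, g ≠ 1 → orderOf g = p := fun g hg =>
    orderOf_eq_prime (by have := Monoid.pow_exponent_eq_one g; rwa [he] at this) hg
  have hzt : z ∉ Subgroup.zpowers t := by
    intro hmem
    have hle : Subgroup.zpowers z ≤ Subgroup.zpowers t := by simpa using hmem
    have heq := Subgroup.eq_of_le_of_card_ge hle (by rw [Nat.card_zpowers, Nat.card_zpowers, hord t ht1, hord z hz1])
    have htm : t ∈ Subgroup.zpowers z := by rw [heq]; exact Subgroup.mem_zpowers t
    obtain ⟨n, rfl⟩ := htm
    apply hst
    exact (Commute.zpow_left (show Commute z s from hzc s) n).eq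
  have hsA : s ∉ Subgroup.closure {t, z} := by
    intro hs
    have : Subgroup.closure {t, z} ≤ Subgroup.centralizer {t} := by
      rw [Subgroup.closure_le]
      rintro x (rfl | rfl)
      · simp [Subgroup.mem_centralizer_iff]
      · simp [Subgroup.mem_centralizer_iff, hzc]
    have := this hs
    rw [Subgroup.mem_centralizer_singleton_iff] at this
    exact hst (by first | exact this | exact this.symm)
  refine ⟨hzt, ?_, hsA⟩
  obtain ⟨k, hk, hc⟩ := (Nat.dvd_prime_pow hp).1 (h ▸ Subgroup.card_subgroup_dvd_card (Subgroup.closure {t, z}))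
  have hlt : Subgroup.zpowers t < Subgroup.closure {t, z} := by
    refine lt_of_le_of_ne (by simpa using Subgroup.subset_closure (by simp)) ?_
    intro heq
    exact hzt (heq ▸ Subgroup.subset_closure (by simp))
  have h1 : p < p ^ k := by
    rw [← hc, ← hord t ht1, ← Nat.card_zpowers]
    by_contra hcon
    exact hlt.ne (Subgroup.eq_of_le_of_card_ge hlt.le (not_lt.1 hcon))
  have hk1 : 1 < k := by
    by_contra hcon
    have := Nat.pow_le_pow_right hp.pos (not_lt.1 hcon)
    rw [pow_one] at this; omega
  have hk3 : k ≠ 3 := by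
    rintro rfl
    have := Subgroup.eq_top_of_card_eq _ (hc.trans h.symm)
    exact hsA (this ▸ Subgroup.mem_top s)
  have hk2 : k = 2 := by omega
  subst hk2
  have hi := Subgroup.card_mul_index (Subgroup.closure {t, z})
  rw [hc, h, pow_succ p 2] at hi
  exact Nat.eq_of_mul_eq_mul_left (pow_pos hp.pos 2) hi

theorem eigen {F K : Type*} [Field F] [Field K] [Algebra F K] {p : ℕ} (hp : p.Prime)
    (hpF : (p : F) ≠ 0) {ζ : F} (hζ : IsPrimitiveRoot ζ p) (g : K ≃ₐ[F] K) (hg : g ^ p = 1)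
    (y : K) (hy : g y ≠ y) :
    ∃ γ : K, γ ≠ 0 ∧ g γ = algebraMap F K ζ * γ ∧
      ∀ n : K ≃ₐ[F] K, (∀ i : ℕ, n ((g ^ i) y) = (g ^ i) y) → n γ = γ := by
  set Y : ℕ → K := fun j => ∑ i ∈ Finset.range p, algebraMap F K (ζ ^ (i * j)) * (g ^ i) y with hY
  have hgY : ∀ j, algebraMap F K (ζ ^ j) * g (Y j) = Y j := by
    intro j
    have e : algebraMap F K (ζ ^ j) * g (Y j) =
        ∑ i ∈ Finset.range p, algebraMap F K (ζ ^ ((i + 1) * j)) * (g ^ (i + 1)) y := by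
      simp only [hY, map_sum, Finset.mul_sum, map_mul, AlgEquiv.commutes]
      refine Finset.sum_congr rfl fun i _ => ?_
      rw [pow_succ' g, AlgEquiv.mul_apply, add_mul, one_mul, pow_add, map_mul]
      ring
    rw [e]
    have h1 := Finset.sum_range_succ (fun i => algebraMap F K (ζ ^ (i * j)) * (g ^ i) y) p
    have h2 := Finset.sum_range_succ' (fun i => algebraMap F K (ζ ^ (i * j)) * (g ^ i) y) p
    have h3 : algebraMap F K (ζ ^ (p * j)) * (g ^ p) y = algebraMap F K (ζ ^ (0 * j)) * (g ^ 0) y := by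
      rw [pow_mul, hζ.pow_eq_one, hg]; simp
    rw [h1, h3] at h2
    exact (add_right_cancel h2).symm
  have hsum : ∑ j ∈ Finset.range p, Y j = (p : K) * y := by
    simp only [hY]
    rw [Finset.sum_comm]
    rw [Finset.sum_eq_single 0]
    · simp
    · intro i hi hi0
      rw [← Finset.sum_mul, ← map_sum]
      have : IsPrimitiveRoot (ζ ^ i) p := hζ.pow_of_coprime i
        ((Nat.coprime_of_lt_prime (Nat.pos_of_ne_zero hi0).ne' (Finset.mem_range.1 hi) hp).symm)
      have := this.geom_sum_eq_zero hp.one_lt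
      simp only [← pow_mul] at this
      rw [this]; simp
    · intro h; exact absurd (Finset.mem_range.2 hp.pos) h
  have hpK : (p : K) ≠ 0 := by
    rw [← map_natCast (algebraMap F K)]; exact (map_ne_zero _).2 hpF
  obtain ⟨j, hj, hj0, hYj⟩ : ∃ j < p, j ≠ 0 ∧ Y j ≠ 0 := by
    by_contra! hcon
    rw [Finset.sum_eq_single 0 (fun j hj hj0 => hcon j (Finset.mem_range.1 hj) hj0)
      (fun h => absurd (Finset.mem_range.2 hp.pos) h)] at hsum
    have h0 := hgY 0
    rw [hsum] at h0
    simp at h0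
    rcases h0 with h0 | h0
    · exact hy h0
    · exact hpK h0
  have hcop : Nat.Coprime j p := (Nat.coprime_of_lt_prime hj0 hj hp).symm
  have hζj : IsPrimitiveRoot ((ζ ^ j)⁻¹) p := (hζ.pow_of_coprime j hcop).inv
  have : NeZero p := ⟨hp.ne_zero⟩
  obtain ⟨m, -, hm⟩ := hζj.eq_pow_of_pow_eq_one hζ.pow_eq_one
  have hζ0 : algebraMap F K (ζ ^ j) ≠ 0 := by
    simpa using pow_ne_zero j (hζ.ne_zero hp.ne_zero)
  refine ⟨Y j ^ m, pow_ne_zero _ hYj, ?_, ?_⟩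
  · have : g (Y j) = algebraMap F K ((ζ ^ j)⁻¹) * Y j := by
      rw [map_inv₀, eq_inv_mul_iff_mul_eq₀ hζ0, hgY]
    rw [map_pow, this, mul_pow, ← map_pow, hm]
  · intro n hn
    rw [map_pow]
    congr 1
    simp only [hY, map_sum, map_mul, AlgEquiv.commutes, hn]

theorem norm_eq_prod_range {F E : Type*} [Field F] [Field E] [Algebra F E] [FiniteDimensional F E]
    [IsGalois F E] {p : ℕ} (hp : p.Prime) (hc : Nat.card (E ≃ₐ[F] E) = p) (σ : E ≃ₐ[F] E)
    (hσ : σ ≠ 1) (x : E) :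
    algebraMap F E (Algebra.norm F x) = ∏ i ∈ Finset.range p, (σ ^ i) x := by
  classical
  have : Fact p.Prime := ⟨hp⟩
  have hord : orderOf σ = p := by
    have := orderOf_dvd_natCard σ
    rw [hc] at this
    exact ((Nat.dvd_prime hp).1 this).resolve_left (by simpa using hσ)
  rw [Algebra.norm_eq_prod_automorphisms, Finset.prod_range]
  refine (Finset.prod_bijective (fun i : Fin p => σ ^ (i : ℕ)) ?_ (by simp) (fun _ _ => rfl)).symm
  rw [Fintype.bijective_iff_injective_and_card]
  refine ⟨?_, by rw [Fintype.card_fin, ← Nat.card_eq_fintype_card, hc]⟩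
  intro i j hij
  exact Fin.ext (pow_injOn_Iio_orderOf (by simp [hord]) (by simp [hord]) hij)

theorem part_one {F K : Type*} [Field F] [Field K] [Algebra F K] [FiniteDimensional F K]
    [IsGalois F K] {p : ℕ} (hp : p.Prime) (hpF : (p : F) ≠ 0) {ζ : F} (hζ : IsPrimitiveRoot ζ p)
    (hn : ∃ a b : K ≃ₐ[F] K, a * b ≠ b * a) (h : Nat.card (K ≃ₐ[F] K) = p ^ 3)
    (he : Monoid.exponent (K ≃ₐ[F] K) = p) :
    ∃ E : IntermediateField F K, IsGalois F E ∧ Nat.card (E ≃ₐ[F] E) = p ∧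
      ∃ θ : E, θ ≠ 0 ∧ ∀ x : E, x ^ p ≠ algebraMap F E (Algebra.norm F θ) := by
  obtain ⟨t, s, hst⟩ := hn
  obtain ⟨z, hz⟩ : ∃ z, z = t⁻¹ * s⁻¹ * t * s := ⟨_, rfl⟩
  obtain ⟨hzt, hidx, hsA⟩ := heis_group hp h he s t z hz hst
  have hzc : ∀ c, z * c = c * z := by rw [hz]; exact heis_comm_central hp h t s
  have hpow : ∀ g : K ≃ₐ[F] K, g ^ p = 1 := fun g => by
    have := Monoid.pow_exponent_eq_one g; rwa [he] at this
  have hts : t * s = s * t * z := by rw [hz]; group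
  set A := Subgroup.closure {t, z} with hA
  have hAn : A.Normal := by
    apply Subgroup.normal_of_index_eq_minFac_card
    rw [hidx, h, hp.pow_minFac (by norm_num)]
  have hmul : ∀ (a b : K ≃ₐ[F] K) (x : K), a (b x) = (a * b) x := fun a b x => rfl
  -- γ
  obtain ⟨γ, hγ0, hzγ, htγ⟩ : ∃ γ : K, γ ≠ 0 ∧ z γ = algebraMap F K ζ * γ ∧ t γ = γ := by
    rw [← IntermediateField.fixingSubgroup_fixedField (Subgroup.zpowers t),
      IntermediateField.mem_fixingSubgroup_iff] at hzt
    push Not at hzt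
    obtain ⟨y, hy, hzy⟩ := hzt
    obtain ⟨γ, h1, h2, h3⟩ := eigen hp hpF hζ z (hpow z) y hzy
    refine ⟨γ, h1, h2, h3 t fun i => ?_⟩
    have hty : t y = y := (IntermediateField.mem_fixedField_iff _ _).1 hy t (Subgroup.mem_zpowers t)
    rw [hmul, ← (Commute.pow_left (show Commute z t from hzc t) i).eq, ← hmul, hty]
  obtain ⟨β, hβ0, htβ, hsβ, hzβ⟩ : ∃ β : K, β ≠ 0 ∧ t β = algebraMap F K ζ * β ∧ s β = β ∧ z β = β := by
    have htN : t ∉ Subgroup.centralizer {s} := by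
      rw [Subgroup.mem_centralizer_singleton_iff]
      intro h; exact hst (by exact h)
    rw [← IntermediateField.fixingSubgroup_fixedField (Subgroup.centralizer {s}),
      IntermediateField.mem_fixingSubgroup_iff] at htN
    push Not at htN
    obtain ⟨y, hy, hty⟩ := htN
    have hy' := (IntermediateField.mem_fixedField_iff _ _).1 hy
    obtain ⟨γ, h1, h2, h3⟩ := eigen hp hpF hζ t (hpow t) y hty
    refine ⟨γ, h1, h2, h3 s fun i => ?_, h3 z fun i => ?_⟩
    · have e : s * t ^ i = t ^ i * (s * (s⁻¹ * (t ^ i)⁻¹ * s * t ^ i)) := by group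
      rw [hmul, e, ← hmul]
      congr 1
      apply hy'
      rw [Subgroup.mem_centralizer_singleton_iff]
      have := heis_comm_central hp h s (t ^ i) s
      rw [mul_assoc, this]
    · rw [hmul, hzc, ← hmul]
      congr 1
      apply hy'
      rw [Subgroup.mem_centralizer_singleton_iff]
      exact hzc s
  have hζ0 : algebraMap F K ζ ≠ 0 := (map_ne_zero _).2 (hζ.ne_zero hp.ne_zero)
  have hsγ0 : s γ ≠ 0 := (map_ne_zero s).2 hγ0
  -- θ
  set θ : K := β * γ / s γ with hθ
  have htθ : t θ = θ := by
    have : t (s γ) = algebraMap F K ζ * s γ := by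
      rw [hmul, hts, ← hmul, hzγ, ← hmul, map_mul, htγ, map_mul, AlgEquiv.commutes, AlgEquiv.commutes]
    rw [hθ, map_div₀, map_mul, this, htβ, htγ]
    field_simp
  have hzθ : z θ = θ := by
    have : z (s γ) = algebraMap F K ζ * s γ := by
      rw [hmul, hzc, ← hmul, hzγ, map_mul, AlgEquiv.commutes]
    rw [hθ, map_div₀, map_mul, this, hzβ, hzγ]
    field_simp
  have hAst : A ≤ MulAction.stabilizer (K ≃ₐ[F] K) θ := by
    rw [hA, Subgroup.closure_le]
    rintro x (rfl | rfl)
    · exact htθ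
    · exact hzθ
  have hθE : θ ∈ IntermediateField.fixedField A := by
    rw [IntermediateField.mem_fixedField_iff]
    intro f hf
    exact hAst hf
  have hGal : IsGalois F (IntermediateField.fixedField A) := inferInstance
  have hcard : Nat.card (IntermediateField.fixedField A ≃ₐ[F] IntermediateField.fixedField A) = p := by
    rw [IsGalois.card_aut_eq_finrank, IntermediateField.finrank_eq_fixingSubgroup_index,
      IntermediateField.fixingSubgroup_fixedField, hidx]
  refine ⟨IntermediateField.fixedField A, hGal, hcard, ⟨θ, hθE⟩, ?_, ?_⟩
  · intro h0
    have : θ = 0 := congrArg Subtype.val h0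
    rw [hθ] at this
    exact div_ne_zero (mul_ne_zero hβ0 hγ0) hsγ0 this
  · intro x hx
    set σ := s.restrictNormal (IntermediateField.fixedField A) with hσ
    have hσx : ∀ y : IntermediateField.fixedField A, ((σ y : IntermediateField.fixedField A) : K) = s y :=
      fun y => s.restrictNormal_commutes _ y
    have hσ1 : σ ≠ 1 := by
      intro h1
      apply hsA
      rw [← IntermediateField.fixingSubgroup_fixedField A, IntermediateField.mem_fixingSubgroup_iff]
      intro y hy
      have := hσx ⟨y, hy⟩
      rw [h1] at this
      exact this.symm
    have hσi : ∀ (i : ℕ) (y : IntermediateField.fixedField A),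
        (((σ ^ i) y : IntermediateField.fixedField A) : K) = (s ^ i) y := by
      intro i
      induction i with
      | zero => intro y; rfl
      | succ i ih => intro y; rw [pow_succ, pow_succ, AlgEquiv.mul_apply, AlgEquiv.mul_apply, ih, hσx]
    rw [norm_eq_prod_range hp hcard σ hσ1] at hx
    have hx' := congrArg (algebraMap (IntermediateField.fixedField A) K) hx
    rw [map_prod, map_pow] at hx'
    simp only [IntermediateField.algebraMap_apply, hσi] at hx'
    have hsiβ : ∀ i : ℕ, (s ^ i) β = β := by
      intro i
      induction i with
      | zero => rfl
      | succ i ih => rw [pow_succ, AlgEquiv.mul_apply, hsβ, ih]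
    have hprod : ∀ n : ℕ, ∏ i ∈ Finset.range n, (s ^ i) θ = β ^ n * γ / (s ^ n) γ := by
      intro n
      induction n with
      | zero => simp [hγ0]
      | succ n ih =>
        have h1 : (s ^ n) γ ≠ 0 := (map_ne_zero _).2 hγ0
        have h2 : (s ^ (n + 1)) γ ≠ 0 := (map_ne_zero _).2 hγ0
        have e : (s ^ n) (s γ) = (s ^ (n + 1)) γ := by rw [pow_succ]; rfl
        rw [Finset.prod_range_succ, ih, hθ, map_div₀, map_mul, hsiβ, e, pow_succ β]
        field_simp
    rw [hprod, hpow s, AlgEquiv.one_apply, mul_div_cancel_right₀ _ hγ0] at hx'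
    have hq : ((x : K) / β) ^ p = 1 := by rw [div_pow, hx', div_self (pow_ne_zero _ hβ0)]
    have : NeZero p := ⟨hp.ne_zero⟩
    obtain ⟨i, -, hi⟩ := (hζ.map_of_injective (algebraMap F K).injective).eq_pow_of_pow_eq_one hq
    have hx2 : (x : K) = algebraMap F K (ζ ^ i) * β := by
      rw [map_pow, hi, div_mul_cancel₀ _ hβ0]
    have htx : t (x : K) = x := (IntermediateField.mem_fixedField_iff _ _).1 x.2 t (Subgroup.subset_closure (by simp))
    rw [hx2, map_mul, AlgEquiv.commutes, htβ] at htx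
    have hb := mul_left_cancel₀ ((map_ne_zero _).2 (pow_ne_zero i (hζ.ne_zero hp.ne_zero))) htx
    have h1 : algebraMap F K ζ = 1 := by
      apply mul_right_cancel₀ hβ0; rw [hb, one_mul]
    have h2 : ζ = 1 := (algebraMap F K).injective (by rw [h1, map_one])
    exact hζ.ne_one hp.one_lt h2

theorem h90 {F E : Type*} [Field F] [Field E] [Algebra F E] [FiniteDimensional F E]
    [IsGalois F E] {p : ℕ} (hp : p.Prime) (hc : Nat.card (E ≃ₐ[F] E) = p) (σ : E ≃ₐ[F] E)
    (hσ : σ ≠ 1) (x : E) (hx : Algebra.norm F x = 1) : ∃ y : Eˣ, (y : E) / σ y = x := by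
  have : Fact p.Prime := ⟨hp⟩
  have hord : orderOf σ = p := by
    have := orderOf_dvd_natCard σ
    rw [hc] at this
    exact ((Nat.dvd_prime hp).1 this).resolve_left (by simpa using hσ)
  have hprod := norm_eq_prod_range hp hc σ hσ x
  rw [hx, map_one] at hprod
  have hli : LinearIndependent E (fun i : Fin p => ((σ ^ (i : ℕ) : E ≃ₐ[F] E) : E → E)) :=
    LinearIndependent.comp (ι' := Fin p)
      (linearIndependent_monoidHom E E) (fun i => ((σ ^ (i : ℕ) : E ≃ₐ[F] E) : E →* E))
      (fun i j h => Fin.ext (pow_injOn_Iio_orderOf (by simp [hord]) (by simp [hord])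
        (AlgEquiv.ext fun z => DFunLike.congr_fun h z)))
  have hne : ∃ c : E, ∑ i ∈ Finset.range p, (∏ k ∈ Finset.range i, (σ ^ k) x) * (σ ^ i) c ≠ 0 := by
    by_contra! hcon
    have := Fintype.linearIndependent_iff.1 hli (fun i => ∏ k ∈ Finset.range i, (σ ^ k) x) (by
      funext c
      have := hcon c
      rw [Finset.sum_range] at this
      simpa using this) ⟨0, hp.pos⟩
    simp at this
  obtain ⟨c, hc⟩ := hne
  refine ⟨Units.mk0 _ hc, ?_⟩
  rw [Units.val_mk0, div_eq_iff ((map_ne_zero σ).2 hc)]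
  set f : ℕ → E := fun i => (∏ k ∈ Finset.range i, (σ ^ k) x) * (σ ^ i) c with hf
  have e : x * σ (∑ i ∈ Finset.range p, f i) = ∑ i ∈ Finset.range p, f (i + 1) := by
    rw [map_sum, Finset.mul_sum]
    refine Finset.sum_congr rfl fun i _ => ?_
    simp only [hf]
    rw [Finset.prod_range_succ', map_mul, map_prod, pow_succ' σ i, AlgEquiv.mul_apply]
    simp only [pow_succ' σ, AlgEquiv.mul_apply, pow_zero, AlgEquiv.one_apply]
    ring
  rw [e]
  have h1 := Finset.sum_range_succ f p
  have h2 := Finset.sum_range_succ' f p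
  have h3 : f p = f 0 := by
    simp only [hf]
    rw [← hprod, ← hord, pow_orderOf_eq_one]; simp
  rw [h1, h3] at h2
  exact add_right_cancel h2

theorem pow_apply_of_scalar {F Ω : Type*} [Field F] [Field Ω] [Algebra F Ω] (g : Ω ≃ₐ[F] Ω)
    (x : Ω) (c : F) (h : g x = algebraMap F Ω c * x) (n : ℕ) :
    (g ^ n) x = algebraMap F Ω (c ^ n) * x := by
  induction n with
  | zero => simp
  | succ n ih =>
    rw [pow_succ, AlgEquiv.mul_apply, h, map_mul, AlgEquiv.commutes, ih, pow_succ, map_mul]; ring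

theorem exists_root_mul {F Ω : Type*} [Field F] [Field Ω] [Algebra F Ω] {p : ℕ} (hp : p.Prime)
    {ζ : F} (hζ : IsPrimitiveRoot ζ p) (x y : Ω) (hy : y ≠ 0) (h : x ^ p = y ^ p) :
    ∃ i : ℕ, x = algebraMap F Ω (ζ ^ i) * y := by
  have : NeZero p := ⟨hp.ne_zero⟩
  have hq : (x / y) ^ p = 1 := by rw [div_pow, h, div_self (pow_ne_zero _ hy)]
  obtain ⟨i, -, hi⟩ := (hζ.map_of_injective (algebraMap F Ω).injective).eq_pow_of_pow_eq_one hq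
  exact ⟨i, by rw [map_pow, hi, div_mul_cancel₀ _ hy]⟩

theorem finrank_adjoin_root_le {E Ω : Type*} [Field E] [Field Ω] [Algebra E Ω] {p : ℕ}
    (hp : p.Prime) (x : Ω) (c : E) (h : x ^ p = algebraMap E Ω c) :
    Module.finrank E (IntermediateField.adjoin E {x}) ≤ p ∧ IsIntegral E x := by
  have hm : (Polynomial.X ^ p - Polynomial.C c).Monic := Polynomial.monic_X_pow_sub_C c hp.ne_zero
  have hr : Polynomial.aeval x (Polynomial.X ^ p - Polynomial.C c) = 0 := by simp [h]
  have hi : IsIntegral E x := ⟨_, hm, hr⟩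
  refine ⟨?_, hi⟩
  rw [IntermediateField.adjoin.finrank hi]
  have := Polynomial.natDegree_le_of_dvd (minpoly.dvd E x hr) hm.ne_zero
  rwa [Polynomial.natDegree_X_pow_sub_C] at this

theorem part_two.{u} {F E : Type u} [Field F] [Field E] [Algebra F E] [FiniteDimensional F E]
    [IsGalois F E] {p : ℕ} (hp : p.Prime) (hodd : p ≠ 2) (hpF : (p : F) ≠ 0) {ζ : F}
    (hζ : IsPrimitiveRoot ζ p) (hc : Nat.card (E ≃ₐ[F] E) = p) (b : F) (η : E)
    (hbη : b * Algebra.norm F η = ζ) (hb : ∀ x : E, x ^ p ≠ algebraMap F E b) :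
    ∃ (L : Type u) (_ : Field L) (_ : Algebra F L), FiniteDimensional F L ∧
      IsGalois F L ∧ (∃ a b : L ≃ₐ[F] L, a * b ≠ b * a) ∧
      Nat.card (L ≃ₐ[F] L) = p ^ 3 ∧ Monoid.exponent (L ≃ₐ[F] L) = p ^ 2 := by
  have : Fact p.Prime := ⟨hp⟩
  have hζ0 : ζ ≠ 0 := hζ.ne_zero hp.ne_zero
  have hζp := hζ.pow_eq_one
  have hb0 : b ≠ 0 := by rintro rfl; exact hζ0 (by rw [← hbη, zero_mul])
  have hη0 : η ≠ 0 := by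
    rintro rfl; exact hζ0 (by rw [← hbη, Algebra.norm_zero, mul_zero])
  -- generator
  obtain ⟨σ, hσ1⟩ : ∃ σ : E ≃ₐ[F] E, σ ≠ 1 := by
    have : Nontrivial (E ≃ₐ[F] E) := by
      rw [← Finite.one_lt_card_iff_nontrivial, hc]; exact hp.one_lt
    exact exists_ne 1
  have hgen : ∀ g : E ≃ₐ[F] E, g ∈ Subgroup.zpowers σ := fun g =>
    mem_zpowers_of_prime_card hc hσ1
  -- Hilbert 90
  obtain ⟨ω, hω⟩ : ∃ ω : Eˣ, σ ω = ω * (algebraMap F E b * η ^ p) := by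
    have hnorm : Algebra.norm F ((algebraMap F E b * η ^ p)⁻¹) = 1 := by
      rw [Algebra.norm_inv, map_mul, map_pow, Algebra.norm_algebraMap,
        ← IsGalois.card_aut_eq_finrank, hc, ← mul_pow, hbη, hζp, inv_one]
    obtain ⟨y, hy⟩ := h90 hp hc σ hσ1 _ hnorm
    refine ⟨y, ?_⟩
    have h1 : σ (y : E) ≠ 0 := (map_ne_zero σ).2 y.ne_zero
    have h2 : algebraMap F E b ≠ 0 := (map_ne_zero _).2 hb0
    rw [div_eq_iff h1] at hy
    have h3 := mul_ne_zero h2 (pow_ne_zero p hη0)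
    rw [eq_inv_mul_iff_mul_eq₀ h3] at hy
    rw [mul_comm, hy]
  have hω0 : (ω : E) ≠ 0 := ω.ne_zero
  have hωi : ∀ i : ℕ, ∃ c : E, c ≠ 0 ∧ (σ ^ i) (ω : E) = ω * (algebraMap F E b ^ i * c ^ p) := by
    intro i
    induction i with
    | zero => exact ⟨1, one_ne_zero, by simp⟩
    | succ i ih =>
      obtain ⟨c, hc0, hc⟩ := ih
      refine ⟨c * (σ ^ i) η, mul_ne_zero hc0 ((map_ne_zero _).2 hη0), ?_⟩
      rw [pow_succ, AlgEquiv.mul_apply, hω, map_mul, hc, map_mul, AlgEquiv.commutes, map_pow]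
      ring
  -- the separable closure
  let Ω := SeparableClosure F
  let j : E →ₐ[F] Ω := IsSepClosed.lift
  let _ : Algebra E Ω := j.toRingHom.toAlgebra
  have htower : IsScalarTower F E Ω := IsScalarTower.of_algebraMap_eq fun x => (j.commutes x).symm
  have hGF : IsGalois F Ω := inferInstance
  have hGE : IsGalois E Ω := IsGalois.tower_top_of_isGalois F E Ω
  have hpΩ : NeZero (p : Ω) := ⟨by
    rw [← map_natCast (algebraMap F Ω)]; exact (map_ne_zero _).2 hpF⟩
  obtain ⟨β, hβ⟩ := IsSepClosed.exists_pow_nat_eq (algebraMap F Ω b) p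
  obtain ⟨ρ, hρ⟩ := IsSepClosed.exists_pow_nat_eq (algebraMap E Ω (ω : E)) p
  have hβ0 : β ≠ 0 := by
    rintro rfl
    rw [zero_pow hp.ne_zero] at hβ
    exact (map_ne_zero (algebraMap F Ω)).2 hb0 hβ.symm
  have hρ0 : ρ ≠ 0 := by
    rintro rfl
    rw [zero_pow hp.ne_zero] at hρ
    exact (map_ne_zero (algebraMap E Ω)).2 hω0 hρ.symm
  have hFE : ∀ x : F, algebraMap E Ω (algebraMap F E x) = algebraMap F Ω x := fun x =>
    (IsScalarTower.algebraMap_apply F E Ω x).symm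
  -- facts on automorphisms
  have hgE : ∀ (g : Ω ≃ₐ[F] Ω) (e : E),
      g (algebraMap E Ω e) = algebraMap E Ω (AlgEquiv.restrictNormalHom E g e) := fun g e =>
    (g.restrictNormal_commutes E e).symm
  have hgβ : ∀ g : Ω ≃ₐ[F] Ω, ∃ i : ℕ, g β = algebraMap F Ω (ζ ^ i) * β := fun g =>
    exists_root_mul hp hζ _ _ hβ0 (by rw [← map_pow, hβ, AlgEquiv.commutes])
  have hgρ : ∀ g : Ω ≃ₐ[F] Ω, ∃ (i k : ℕ) (c : E),
      g ρ = algebraMap F Ω (ζ ^ i) * (ρ * β ^ k * algebraMap E Ω c) := by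
    intro g
    obtain ⟨k, hk⟩ := (mem_powers_iff_mem_zpowers (x := σ)).2 (hgen (AlgEquiv.restrictNormalHom E g))
    obtain ⟨c, hc0, hc⟩ := hωi k
    obtain ⟨i, hi⟩ := exists_root_mul hp hζ (g ρ) (ρ * β ^ k * algebraMap E Ω c)
      (mul_ne_zero (mul_ne_zero hρ0 (pow_ne_zero _ hβ0)) ((map_ne_zero _).2 hc0)) (by
        have hk' : σ ^ k = AlgEquiv.restrictNormalHom E g := hk
        rw [← map_pow, hρ, hgE, ← hk', hc, mul_pow, mul_pow, hρ, ← pow_mul, mul_comm k p, pow_mul, hβ,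
          map_mul, map_mul, map_pow, map_pow, hFE]
        ring)
    exact ⟨i, k, c, hi⟩
  -- the field
  let L₀ : IntermediateField E Ω := IntermediateField.adjoin E {β, ρ}
  let L : IntermediateField F Ω := L₀.restrictScalars F
  have hLE : ∀ e : E, algebraMap E Ω e ∈ L := fun e => L₀.algebraMap_mem e
  have hLβ : β ∈ L := IntermediateField.subset_adjoin E _ (by simp)
  have hLρ : ρ ∈ L := IntermediateField.subset_adjoin E _ (by simp)
  have hLF : ∀ e : F, algebraMap F Ω e ∈ L := fun e => L.algebraMap_mem e
  have hLind : ∀ P : Ω → Prop, (∀ e : E, P (algebraMap E Ω e)) → P β → P ρ →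
      (∀ x y, P x → P y → P (x + y)) → (∀ x, P x → P x⁻¹) → (∀ x y, P x → P y → P (x * y)) →
      ∀ x ∈ L, P x := by
    intro P h1 h2 h3 h4 h5 h6 x hx0
    have hx' : x ∈ IntermediateField.adjoin E {β, ρ} := hx0
    clear hx0
    induction hx' using IntermediateField.adjoin_induction with
    | mem x hx' =>
      rcases hx' with rfl | rfl
      · exact h2
      · exact h3
    | algebraMap e => exact h1 e
    | add x y hx hy ihx ihy => exact h4 x y ihx ihy
    | inv x hx ih => exact h5 x ih
    | mul x y hx hy ihx ihy => exact h6 x y ihx ihy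
  have hnormal : Normal F L := by
    rw [IntermediateField.normal_iff_forall_map_le']
    rintro g x ⟨y, hy, rfl⟩
    change g y ∈ L
    refine hLind (fun y => g y ∈ L) ?_ ?_ ?_ ?_ ?_ ?_ y hy
    · intro e; rw [hgE]; exact hLE _
    · obtain ⟨i, hi⟩ := hgβ g
      rw [hi]; exact mul_mem (hLF _) hLβ
    · obtain ⟨i, k, c, hi⟩ := hgρ g
      rw [hi]; exact mul_mem (hLF _) (mul_mem (mul_mem hLρ (pow_mem hLβ _)) (hLE _))
    · intro x y hx hy; rw [map_add]; exact add_mem hx hy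
    · intro x hx; rw [map_inv₀]; exact inv_mem hx
    · intro x y hx hy; rw [map_mul]; exact mul_mem hx hy
  have hgal : IsGalois F L := ⟨⟩
  -- degrees
  obtain ⟨hdβ, hiβ⟩ := finrank_adjoin_root_le hp β (algebraMap F E b) (by rw [hβ, hFE])
  obtain ⟨hdρ, hiρ⟩ := finrank_adjoin_root_le hp ρ (ω : E) hρ
  have hL₀eq : L₀ = IntermediateField.adjoin E {β} ⊔ IntermediateField.adjoin E {ρ} := by
    rw [← IntermediateField.adjoin_union]; rfl
  have hfd1 : FiniteDimensional E (IntermediateField.adjoin E {β}) :=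
    IntermediateField.adjoin.finiteDimensional hiβ
  have hfd2 : FiniteDimensional E (IntermediateField.adjoin E {ρ}) :=
    IntermediateField.adjoin.finiteDimensional hiρ
  have hfd3 : FiniteDimensional E L₀ := by
    rw [hL₀eq]; exact IntermediateField.finiteDimensional_sup _ _
  have hfd : FiniteDimensional F L := by
    have : FiniteDimensional F L₀ := FiniteDimensional.trans F E L₀
    exact this
  have hdeg : Module.finrank F L ≤ p ^ 3 := by
    have h1 : Module.finrank F L₀ = Module.finrank F E * Module.finrank E L₀ :=
      (Module.finrank_mul_finrank F E L₀).symm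
    have h2 : Module.finrank E L₀ ≤ p * p := by
      rw [hL₀eq]
      exact (IntermediateField.finrank_sup_le _ _).trans (Nat.mul_le_mul hdβ hdρ)
    have h3 : Module.finrank F E = p := by rw [← IsGalois.card_aut_eq_finrank, hc]
    calc Module.finrank F L = Module.finrank F E * Module.finrank E L₀ := h1
      _ ≤ p * (p * p) := by rw [h3]; exact Nat.mul_le_mul_left _ h2
      _ = p ^ 3 := by ring
  -- restriction
  let r : (Ω ≃ₐ[F] Ω) →* (L ≃ₐ[F] L) := AlgEquiv.restrictNormalHom L
  have hr : ∀ (g : Ω ≃ₐ[F] Ω) (x : L), ((r g x : L) : Ω) = g x := fun g x =>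
    g.restrictNormal_commutes L x
  have hr1 : ∀ g h : Ω ≃ₐ[F] Ω, r g = r h → ∀ x ∈ L, g x = h x := by
    intro g h hgh x hx
    rw [← hr g ⟨x, hx⟩, hgh, hr]
  have hrsurj : Function.Surjective r := AlgEquiv.restrictNormalHom_surjective Ω
  -- exponent divides
  have hexp : ∀ γ : L ≃ₐ[F] L, γ ^ (p ^ 2) = 1 := by
    intro γ
    obtain ⟨g, rfl⟩ := hrsurj γ
    have hpE : ∀ e : E, (g ^ p) (algebraMap E Ω e) = algebraMap E Ω e := by
      intro e
      rw [hgE, map_pow]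
      have : (AlgEquiv.restrictNormalHom E g) ^ p = 1 := by
        rw [← hc]; exact pow_card_eq_one'
      rw [this, AlgEquiv.one_apply]
    have hpβ : (g ^ p) β = β := by
      obtain ⟨i, hi⟩ := hgβ g
      rw [pow_apply_of_scalar g β _ hi, pow_right_comm, hζp, one_pow, map_one, one_mul]
    obtain ⟨i, hi⟩ := exists_root_mul hp hζ ((g ^ p) ρ) ρ hρ0 (by rw [← map_pow, hρ, hpE])
    have h1 : ((g ^ p) ^ p) ρ = ρ := by
      rw [pow_apply_of_scalar (g ^ p) ρ _ hi, pow_right_comm, hζp, one_pow, map_one,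
        one_mul]
    have h0 := pow_apply_of_scalar (F := F) (g ^ p)
    have hall : ∀ x ∈ L, ((g ^ p) ^ p) x = x := by
      refine hLind _ ?_ ?_ h1 ?_ ?_ ?_
      · intro e
        rw [h0 _ 1 (by rw [hpE]; simp)]; simp
      · rw [h0 _ 1 (by rw [hpβ]; simp)]; simp
      · intro x y hx hy; rw [map_add, hx, hy]
      · intro x hx; rw [map_inv₀, hx]
      · intro x y hx hy; rw [map_mul, hx, hy]
    rw [← map_pow, sq, pow_mul]
    ext x
    rw [hr, hall x x.2]; rfl
  -- lifts
  obtain ⟨s, hs⟩ := AlgEquiv.restrictNormalHom_surjective (F := F) (K₁ := E) Ω σ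
  have hsn : ∀ (n : ℕ) (e : E), (s ^ n) (algebraMap E Ω e) = algebraMap E Ω ((σ ^ n) e) := by
    intro n e; rw [hgE, map_pow, hs]
  obtain ⟨i, hi⟩ := hgβ s
  obtain ⟨m, hm⟩ := exists_root_mul hp hζ (s ρ) (ρ * β * algebraMap E Ω η)
    (mul_ne_zero (mul_ne_zero hρ0 hβ0) ((map_ne_zero _).2 hη0)) (by
      have := hsn 1 ω
      rw [pow_one, pow_one] at this
      rw [← map_pow, hρ, this, hω, mul_pow, mul_pow, hρ, hβ, map_mul, map_mul, hFE, map_pow]; ring)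
  have hsρ : ∀ n : ℕ, (s ^ n) ρ = algebraMap F Ω ((ζ ^ m) ^ n * ∏ k ∈ Finset.range n, (ζ ^ i) ^ k) *
      (ρ * β ^ n * algebraMap E Ω (∏ k ∈ Finset.range n, (σ ^ k) η)) := by
    intro n
    induction n with
    | zero => simp
    | succ n ih =>
      rw [pow_succ s, AlgEquiv.mul_apply, hm, map_mul, map_mul, map_mul, ih, hsn,
        pow_apply_of_scalar s β _ hi, AlgEquiv.commutes, Finset.prod_range_succ,
        Finset.prod_range_succ, pow_succ (ζ ^ m)]
      simp only [map_mul]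
      ring
  have hsp : (s ^ p) ρ = algebraMap F Ω ζ * ρ := by
    have h1 : (ζ ^ m) ^ p = 1 := by rw [← pow_mul, mul_comm, pow_mul, hζp, one_pow]
    have h2 : ∏ k ∈ Finset.range p, (ζ ^ i) ^ k = 1 := by
      rw [Finset.prod_pow_eq_pow_sum, Finset.sum_range_id]
      obtain ⟨q, hq⟩ := hp.odd_of_ne_two hodd
      have : p * (p - 1) / 2 = p * q := by
        rw [show p - 1 = q * 2 by omega, ← mul_assoc, Nat.mul_div_cancel _ (by norm_num)]
      rw [this, ← pow_mul, mul_left_comm, pow_mul, hζp, one_pow]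
    rw [hsρ, h1, h2, ← norm_eq_prod_range hp hc σ hσ1, hβ, hFE, ← hbη]
    simp only [map_mul, map_one]
    ring
  obtain ⟨τ, hτ⟩ : ∃ τ : Ω ≃ₐ[E] Ω, τ β ≠ β := by
    by_contra! hcon
    obtain ⟨x, hx⟩ := (InfiniteGalois.mem_range_algebraMap_iff_fixed (k := E) β).2 hcon
    apply hb x
    apply (algebraMap E Ω).injective
    rw [map_pow, hx, hβ, hFE]
  let t : Ω ≃ₐ[F] Ω := τ.restrictScalars F
  have ht : ∀ x, t x = τ x := fun x => rfl
  obtain ⟨l, hl⟩ := exists_root_mul hp hζ (t ρ) ρ hρ0 (by rw [← map_pow, hρ, ht, AlgEquiv.commutes])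
  have hncomm : r s * r t ≠ r t * r s := by
    intro hcomm
    rw [← map_mul, ← map_mul] at hcomm
    have := hr1 _ _ hcomm ρ hLρ
    rw [AlgEquiv.mul_apply, AlgEquiv.mul_apply, hl, hm, map_mul, hm, AlgEquiv.commutes, map_mul, map_mul,
      map_mul, hl, AlgEquiv.commutes, ht (algebraMap E Ω η), AlgEquiv.commutes] at this
    apply hτ
    rw [← ht]
    have h1 : algebraMap F Ω (ζ ^ l) ≠ 0 := (map_ne_zero _).2 (pow_ne_zero _ hζ0)
    have h2 : algebraMap F Ω (ζ ^ m) ≠ 0 := (map_ne_zero _).2 (pow_ne_zero _ hζ0)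
    have h3 : algebraMap E Ω η ≠ 0 := (map_ne_zero _).2 hη0
    have h4 := mul_ne_zero (mul_ne_zero h1 h2) (mul_ne_zero h3 hρ0)
    apply mul_left_cancel₀ h4
    linear_combination -this
  have hexpdvd : Monoid.exponent (L ≃ₐ[F] L) ∣ p ^ 2 := Monoid.exponent_dvd_of_forall_pow_eq_one hexp
  refine ⟨L, inferInstance, inferInstance, hfd, hgal, ⟨r s, r t, hncomm⟩, ?_, ?_⟩
  · obtain ⟨n, hn⟩ := (IsPGroup.iff_card (p := p)).1 (IsPGroup.of_exponent_dvd_pow hexpdvd)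
    have h1 : p ^ n ≤ p ^ 3 := by rw [← hn, IsGalois.card_aut_eq_finrank]; exact hdeg
    have h2 : n ≤ 3 := (Nat.pow_le_pow_iff_right hp.one_lt).1 h1
    have h3 : ¬ n ≤ 2 := fun h => hncomm (comm_of_card_pow_le hp h hn _ _)
    rw [hn, show n = 3 by omega]
  · obtain ⟨n, hn2, hn⟩ := (Nat.dvd_prime_pow hp).1 hexpdvd
    have h3 : ¬ n ≤ 1 := by
      intro h
      have hd : Monoid.exponent (L ≃ₐ[F] L) ∣ p := by
        rw [hn]; simpa using pow_dvd_pow p h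
      have h1 : (r s) ^ p = 1 := Monoid.exponent_dvd_iff_forall_pow_eq_one.1 hd (r s)
      rw [← map_pow, ← map_one r] at h1
      have h2 := hr1 _ _ h1 ρ hLρ
      rw [hsp, AlgEquiv.one_apply] at h2
      have h4 : algebraMap F Ω ζ = 1 := mul_right_cancel₀ hρ0 (by rw [h2, one_mul])
      exact hζ.ne_one hp.one_lt ((algebraMap F Ω).injective (by rw [h4, map_one]))
    rw [hn, show n = 2 by omega]

/-- Let `p` be an odd prime and `F` a field of characteristic `≠ p` containing a primitive
`p`-th root of unity.  If there is a finite Galois extension `K/F` with `Gal(K/F)` a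
nonabelian group of order `p³` and exponent `p` (the Heisenberg group `H_{p³}`), then there
is a finite Galois extension `L/F` with `Gal(L/F)` a nonabelian group of order `p³` and
exponent `p²` (the modular group `M_{p³}`). -/
theorem heisenberg_realizable_implies_modular_realizable.{u}
    (p : ℕ) (hp : p.Prime) (hodd : p ≠ 2) (F : Type u) [Field F]
    (hchar : ringChar F ≠ p) (hroot : ∃ ζ : F, IsPrimitiveRoot ζ p)
    (hH : ∃ (K : Type u) (_ : Field K) (_ : Algebra F K), FiniteDimensional F K ∧
      IsGalois F K ∧ (∃ a b : K ≃ₐ[F] K, a * b ≠ b * a) ∧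
      Nat.card (K ≃ₐ[F] K) = p ^ 3 ∧ Monoid.exponent (K ≃ₐ[F] K) = p) :
    ∃ (L : Type u) (_ : Field L) (_ : Algebra F L), FiniteDimensional F L ∧
      IsGalois F L ∧ (∃ a b : L ≃ₐ[F] L, a * b ≠ b * a) ∧
      Nat.card (L ≃ₐ[F] L) = p ^ 3 ∧ Monoid.exponent (L ≃ₐ[F] L) = p ^ 2 := by
  obtain ⟨ζ, hζ⟩ := hroot
  obtain ⟨K, _, _, hfd, hgal, hn, hcard, hexp⟩ := hH
  have hpF : (p : F) ≠ 0 := by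
    intro h0
    rcases (Nat.dvd_prime hp).1 ((ringChar.spec F p).1 h0) with h1 | h1
    · have := ringChar.spec F 1
      rw [h1] at this
      simp at this
    · exact hchar h1
  obtain ⟨E, hE, hEc, θ, hθ0, hθ⟩ := part_one hp hpF hζ hn hcard hexp
  have hN0 : Algebra.norm F θ ≠ 0 := by rwa [Ne, Algebra.norm_eq_zero_iff]
  by_cases h1 : ∀ x : E, x ^ p ≠ algebraMap F E (Algebra.norm F θ * ζ)
  · refine part_two hp hodd hpF hζ hEc _ θ⁻¹ ?_ h1
    rw [Algebra.norm_inv]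
    field_simp
  · push Not at h1
    obtain ⟨x, hx⟩ := h1
    refine part_two hp hodd hpF hζ hEc (Algebra.norm F θ ^ 2 * ζ) (θ ^ 2)⁻¹ ?_ ?_
    · rw [Algebra.norm_inv, map_pow]
      field_simp
    · intro y hy
      apply hθ (y / x)
      have hζ0 := hζ.ne_zero hp.ne_zero
      rw [div_pow, hx, hy, ← map_div₀]
      congr 1
      field_simp
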